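/- arXiv:1808.10422 — 4 statements merged into one kernel-verified Lean document; each statement's English description precedes it below -/
import Mathlib

section
/- If U ⊆ M¹ is open in the free topology and M ∈ U, then every eigenvalue λ of M, regarded as a 1×1 matrix, belongs to U; that is, σ(M) ⊆ U ∩ M¹₁, where M¹₁ is the set of 1×1 matrices. -/
open Topology

noncomputable section

/-- The operator norm of a rectangular complex matrix, i.e. the norm of the induced
linear map between Euclidean spaces. -/
noncomputable def opNorm {m n : Type*} [Fintype m] [Fintype n] [DecidableEq n]
    (A : Matrix m n ℂ) : ℝ :=
  ‖LinearMap.toContinuousLinearMap (Matrix.toEuclideanLin A)‖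

/-- `M¹`: the disjoint union over `n ≥ 1` of the `n × n` complex matrices. -/
def M1 : Type := Σ n : ℕ, Matrix (Fin (n + 1)) (Fin (n + 1)) ℂ

/-- Block evaluation `δ(x)` of an `I × J` matrix of one-variable polynomials at a
square matrix `x`. -/
noncomputable def evalDelta1 {I J n : ℕ} (δ : Matrix (Fin I) (Fin J) (Polynomial ℂ))
    (x : Matrix (Fin n) (Fin n) ℂ) : Matrix (Fin I × Fin n) (Fin J × Fin n) ℂ :=
  Matrix.of fun p q => (Polynomial.aeval x (δ p.1 q.1)) p.2 q.2

/-- The basic free open set `B_δ = {x ∈ M¹ : ‖δ(x)‖ < 1}`. -/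
noncomputable def Bdelta1 {I J : ℕ} (δ : Matrix (Fin I) (Fin J) (Polynomial ℂ)) : Set M1 :=
  { x | opNorm (evalDelta1 δ x.2) < 1 }

/-- The free topology on `M¹`: the topology with the sets `B_δ` as a basis
(the `B_δ` are closed under pairwise intersection, so generating from them as a
subbasis yields the topology having them as a basis). -/
def freeTopology1 : TopologicalSpace M1 :=
  TopologicalSpace.generateFrom
    { U | ∃ (I J : ℕ) (δ : Matrix (Fin I) (Fin J) (Polynomial ℂ)), U = Bdelta1 δ }

instance : TopologicalSpace M1 := freeTopology1

lemma norm_tensor {J n : ℕ} (w : EuclideanSpace ℂ (Fin J × Fin 1)) (v : Fin n → ℂ) :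
    ‖(WithLp.toLp 2 (fun p : Fin J × Fin n => w (p.1, 0) * v p.2) :
      EuclideanSpace ℂ (Fin J × Fin n))‖
      = ‖w‖ * ‖(WithLp.toLp 2 v : EuclideanSpace ℂ (Fin n))‖ := by
  rw [EuclideanSpace.norm_eq, EuclideanSpace.norm_eq, EuclideanSpace.norm_eq,
    ← Real.sqrt_mul (by positivity)]
  congr 1
  simp [Fintype.sum_prod_type, mul_pow, Finset.sum_mul_sum]

lemma aeval_mulVec {n : ℕ} (x : Matrix (Fin n) (Fin n) ℂ) (v : Fin n → ℂ) (lam : ℂ)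
    (h : x.mulVec v = lam • v) (p : Polynomial ℂ) :
    (Polynomial.aeval x p).mulVec v = (p.eval lam) • v := by
  induction p using Polynomial.induction_on' with
  | add p q hp hq => simp [Matrix.add_mulVec, hp, hq, add_smul]
  | monomial k a =>
    have hk : ∀ k : ℕ, (x ^ k).mulVec v = lam ^ k • v := by
      intro k
      induction k with
      | zero => simp
      | succ k ih =>
        rw [pow_succ, ← Matrix.mulVec_mulVec, h, Matrix.mulVec_smul, ih, smul_smul, pow_succ,
          mul_comm]
    rw [Polynomial.aeval_monomial, Polynomial.eval_monomial, ← Matrix.mulVec_mulVec, hk,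
      Matrix.mulVec_smul, Algebra.algebraMap_eq_smul_one, Matrix.smul_mulVec, Matrix.one_mulVec,
      smul_smul, mul_comm]

lemma opNorm_le {I J n : ℕ} (δ : Matrix (Fin I) (Fin J) (Polynomial ℂ))
    (x : Matrix (Fin n) (Fin n) ℂ) (v : Fin n → ℂ) (hv : v ≠ 0) (lam : ℂ)
    (h : x.mulVec v = lam • v) :
    opNorm (evalDelta1 δ (Matrix.of fun _ _ : Fin 1 => lam)) ≤ opNorm (evalDelta1 δ x) := by
  unfold opNorm
  refine ContinuousLinearMap.opNorm_le_bound _ (norm_nonneg _) fun w => ?_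
  have hv' : 0 < ‖(WithLp.toLp 2 v : EuclideanSpace ℂ (Fin n))‖ := by
    rw [norm_pos_iff]
    intro h0
    exact hv (by simpa using h0)
  have key := ContinuousLinearMap.le_opNorm
    (LinearMap.toContinuousLinearMap (Matrix.toEuclideanLin (evalDelta1 δ x)))
    (WithLp.toLp 2 (fun p : Fin J × Fin n => w (p.1, 0) * v p.2))
  have h1 : (Matrix.of fun _ _ : Fin 1 => lam).mulVec (fun _ => (1:ℂ)) = lam • (fun _ => (1:ℂ)) := by
    ext i; simp [Matrix.mulVec, dotProduct]
  have e : (LinearMap.toContinuousLinearMap (Matrix.toEuclideanLin (evalDelta1 δ x)))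
      (WithLp.toLp 2 (fun p : Fin J × Fin n => w (p.1, 0) * v p.2)) =
      WithLp.toLp 2 (fun p : Fin I × Fin n =>
        ((LinearMap.toContinuousLinearMap (Matrix.toEuclideanLin
          (evalDelta1 δ (Matrix.of fun _ _ : Fin 1 => lam)))) w) (p.1, 0) * v p.2) := by
    ext ⟨i, k⟩
    simp only [LinearMap.coe_toContinuousLinearMap', Matrix.toLpLin_apply, Matrix.mulVec,
      dotProduct, Fintype.sum_prod_type, evalDelta1, Matrix.of_apply, Finset.univ_unique,
      Fin.default_eq_zero, Finset.sum_singleton, Finset.sum_mul]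
    refine Finset.sum_congr rfl fun j _ => ?_
    have a1 := congrFun (aeval_mulVec x v lam h (δ i j)) k
    have a2 := congrFun (aeval_mulVec _ _ lam h1 (δ i j)) 0
    simp only [Matrix.mulVec, dotProduct, Finset.univ_unique, Fin.default_eq_zero,
      Finset.sum_singleton, Pi.smul_apply, smul_eq_mul, mul_one] at a1 a2
    rw [a2, mul_right_comm, ← a1, Finset.sum_mul]
    exact Finset.sum_congr rfl fun l _ => by ring
  rw [e, norm_tensor, norm_tensor, ← mul_assoc] at key
  exact le_of_mul_le_mul_right key hv'

/-- If `U ⊆ M¹` is freely open and `M ∈ U`, then every eigenvalue of `M`, regarded as a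
`1 × 1` matrix, belongs to `U`. -/
theorem spectrum_subset_of_freely_open (U : Set M1) (hU : IsOpen U) (M : M1) (hM : M ∈ U) :
    ∀ lam ∈ spectrum ℂ M.2, (⟨0, Matrix.of fun _ _ => lam⟩ : M1) ∈ U := by
  intro lam hlam
  obtain ⟨v, hv, h⟩ : ∃ v, v ≠ 0 ∧ M.2.mulVec v = lam • v := by
    rw [← Matrix.spectrum_toLin', ← Module.End.hasEigenvalue_iff_mem_spectrum] at hlam
    obtain ⟨v, hv⟩ := hlam.exists_hasEigenvector
    exact ⟨v, hv.2, by simpa using hv.apply_eq_smul⟩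
  have hU' : TopologicalSpace.GenerateOpen
    { U | ∃ (I J : ℕ) (δ : Matrix (Fin I) (Fin J) (Polynomial ℂ)), U = Bdelta1 δ } U := hU
  clear hU
  induction hU' with
  | basic s hs =>
    obtain ⟨I, J, δ, rfl⟩ := hs
    exact lt_of_le_of_lt (opNorm_le δ M.2 v hv lam h) hM
  | univ => trivial
  | inter s t _ _ hs ht => exact ⟨hs hM.1, ht hM.2⟩
  | sUnion S _ ih =>
    obtain ⟨t, ht, hMt⟩ := hM
    exact ⟨t, ht, ih t ht hMt⟩
end
end

section
/- Every nonempty subset of M¹ that is open in the free topology contains a 1×1 matrix; equivalently, if δ is a matrix of polynomials in ℂ[X] and ‖δ(M)‖ < 1 for some square complex matrix M, then there exists λ ∈ ℂ with ‖δ(λ)‖ < 1. -/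
open Topology

noncomputable section

/-- Eigenvector relation for polynomials in a matrix. -/
theorem aux_aeval_mulVec {n : ℕ} (M : Matrix (Fin n) (Fin n) ℂ) (lam : ℂ) (v : Fin n → ℂ)
    (hv : Module.End.HasEigenvector (Matrix.toLin' M) lam v) (p : Polynomial ℂ) :
    (Polynomial.aeval M p).mulVec v = p.eval lam • v := by
  have h1 := Module.End.aeval_apply_of_hasEigenvector (p := p) hv
  have h2 : Polynomial.aeval (Matrix.toLin' M) p = Matrix.toLin' (Polynomial.aeval M p) :=
    Polynomial.aeval_algHom_apply (Matrix.toLinAlgEquiv' : _ ≃ₐ[ℂ] _).toAlgHom M p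
  rw [h2, Matrix.toLin'_apply] at h1
  exact h1

theorem aux_aeval_scalar (lam : ℂ) (p : Polynomial ℂ) (i j : Fin 1) :
    (Polynomial.aeval (Matrix.of fun _ _ => lam : Matrix (Fin 1) (Fin 1) ℂ) p) i j
      = p.eval lam := by
  have h : (Matrix.of fun _ _ => lam : Matrix (Fin 1) (Fin 1) ℂ) = algebraMap ℂ _ lam := by
    ext a b
    rw [Subsingleton.elim a b]
    simp [Matrix.algebraMap_matrix_apply]
  rw [h, Polynomial.aeval_algebraMap_apply, Subsingleton.elim i j]
  simp [Matrix.algebraMap_matrix_apply]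

/-- The elementary tensor `w ⊗ v`. -/
def auxTensor {J n : ℕ} (w : EuclideanSpace ℂ (Fin J × Fin 1)) (v : Fin n → ℂ) :
    EuclideanSpace ℂ (Fin J × Fin n) :=
  WithLp.toLp 2 fun q => w (q.1, 0) * v q.2

theorem aux_norm_tensor {J n : ℕ} (w : EuclideanSpace ℂ (Fin J × Fin 1)) (v : Fin n → ℂ) :
    ‖auxTensor w v‖ = ‖w‖ * ‖(WithLp.toLp 2 v : EuclideanSpace ℂ (Fin n))‖ := by
  rw [EuclideanSpace.norm_eq, EuclideanSpace.norm_eq, EuclideanSpace.norm_eq,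
    ← Real.sqrt_mul (Finset.sum_nonneg fun _ _ => sq_nonneg _)]
  congr 1
  simp [auxTensor, Fintype.sum_prod_type, mul_pow, Finset.sum_mul_sum]

theorem aux_opNorm_le {I J n : ℕ} (δ : Matrix (Fin I) (Fin J) (Polynomial ℂ))
    (M : Matrix (Fin n) (Fin n) ℂ) (lam : ℂ) (v : Fin n → ℂ)
    (hv : Module.End.HasEigenvector (Matrix.toLin' M) lam v) :
    opNorm (evalDelta1 δ (Matrix.of fun _ _ => lam : Matrix (Fin 1) (Fin 1) ℂ))
      ≤ opNorm (evalDelta1 δ M) := by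
  unfold opNorm
  refine ContinuousLinearMap.opNorm_le_bound _ (norm_nonneg _) fun w => ?_
  have hpos : 0 < ‖(WithLp.toLp 2 v : EuclideanSpace ℂ (Fin n))‖ := by
    rw [norm_pos_iff]
    intro h
    apply hv.2
    exact congrArg WithLp.ofLp h
  refine le_of_mul_le_mul_right ?_ hpos
  rw [mul_assoc, ← aux_norm_tensor, ← aux_norm_tensor]
  refine le_trans (le_of_eq ?_) (ContinuousLinearMap.le_opNorm _ _)
  congr 1
  ext q
  obtain ⟨i, a⟩ := q
  have key : ∀ j : Fin J, ∑ b, (Polynomial.aeval M (δ i j)) a b * v b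
      = (δ i j).eval lam * v a := fun j => by
    have := congrFun (aux_aeval_mulVec M lam v hv (δ i j)) a
    simpa [Matrix.mulVec, dotProduct] using this
  simp only [auxTensor, LinearMap.coe_toContinuousLinearMap', Matrix.toLpLin_apply,
    Matrix.mulVec, dotProduct, evalDelta1, Matrix.of_apply, Fintype.sum_prod_type,
    aux_aeval_scalar, Finset.univ_unique, Finset.sum_singleton, Finset.sum_mul]
  refine Finset.sum_congr rfl fun j _ => ?_
  have h := congrArg (fun z => w (j, 0) * z) (key j)
  simp only [Finset.mul_sum] at h
  calc _ = w (j, 0) * ((δ i j).eval lam * v a) := by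
        simp only [Fin.default_eq_zero]; ring
    _ = _ := by
        rw [← h]
        exact Finset.sum_congr rfl fun b _ => by ring

theorem aux_exists (M : M1) :
    ∃ lam : ℂ, ∃ v, Module.End.HasEigenvector (Matrix.toLin' M.2) lam v := by
  obtain ⟨lam, hl⟩ := Module.End.exists_eigenvalue (Matrix.toLin' M.2)
  exact ⟨lam, hl.exists_hasEigenvector⟩

theorem aux_mem {I J : ℕ} (δ : Matrix (Fin I) (Fin J) (Polynomial ℂ)) (M : M1) (lam : ℂ)
    (v) (hv : Module.End.HasEigenvector (Matrix.toLin' M.2) lam v) (hM : M ∈ Bdelta1 δ) :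
    (⟨0, Matrix.of fun _ _ => lam⟩ : M1) ∈ Bdelta1 δ :=
  lt_of_le_of_lt (aux_opNorm_le δ M.2 lam v hv) hM

/-- Every nonempty freely open subset of `M¹` contains a `1 × 1` matrix; equivalently, if
`‖δ(M)‖ < 1` for some square matrix `M`, then `‖δ(λ)‖ < 1` for some scalar `λ`. -/
theorem freely_open_meets_level_one :
    (∀ U : Set M1, IsOpen U → U.Nonempty →
      ∃ lam : ℂ, (⟨0, Matrix.of fun _ _ => lam⟩ : M1) ∈ U) ∧
    (∀ (I J : ℕ) (δ : Matrix (Fin I) (Fin J) (Polynomial ℂ)) (M : M1),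
      M ∈ Bdelta1 δ → ∃ lam : ℂ, (⟨0, Matrix.of fun _ _ => lam⟩ : M1) ∈ Bdelta1 δ) := by
  constructor
  · rintro U hU ⟨M, hM⟩
    obtain ⟨lam, v, hv⟩ := aux_exists M
    refine ⟨lam, ?_⟩
    change TopologicalSpace.GenerateOpen _ U at hU
    induction hU with
    | basic s hs =>
      obtain ⟨I, J, δ, rfl⟩ := hs
      exact aux_mem δ M lam v hv hM
    | univ => trivial
    | inter s t _ _ ihs iht => exact ⟨ihs hM.1, iht hM.2⟩
    | sUnion S _ ih =>
      obtain ⟨s, hs, hMs⟩ := hM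
      exact ⟨s, hs, ih s hs hMs⟩
  · intro I J δ M hM
    obtain ⟨lam, v, hv⟩ := aux_exists M
    exact ⟨lam, aux_mem δ M lam v hv hM⟩
end
end

section
/- The set Inv = {x ∈ M¹ : x is invertible} and the set Q = {x ∈ M¹ : σ(x) ∩ σ(−x) = ∅} are both open and connected in the free topology on M¹. -/
open Topology

noncomputable section

/-- A matrix as a point of `M1`. -/
def mk1 (n : ℕ) (x : Matrix (Fin (n + 1)) (Fin (n + 1)) ℂ) : M1 := ⟨n, x⟩

theorem opNorm_eval_lt {n : ℕ} (f : Polynomial ℂ) (y : Matrix (Fin n) (Fin n) ℂ) (l : ℂ)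
    (hl : l ∈ spectrum ℂ y)
    (h : opNorm (evalDelta1 (I := 1) (J := 1) (Matrix.of fun _ _ => f) y) < 1) :
    ‖f.eval l‖ < 1 := by
  have h1 : f.eval l ∈ spectrum ℂ (Polynomial.aeval y f) :=
    spectrum.subset_polynomial_aeval y f ⟨l, hl, rfl⟩
  rw [spectrum.mem_iff, Matrix.isUnit_iff_isUnit_det, isUnit_iff_ne_zero, not_not,
    ← Matrix.exists_mulVec_eq_zero_iff] at h1
  obtain ⟨v, hv0, hv⟩ := h1
  rw [Matrix.sub_mulVec, sub_eq_zero, Algebra.algebraMap_eq_smul_one, Matrix.smul_mulVec,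
    Matrix.one_mulVec] at hv
  set A := evalDelta1 (I := 1) (J := 1) (Matrix.of fun _ _ => f) y with hA
  let w : EuclideanSpace ℂ (Fin 1 × Fin n) := WithLp.toLp 2 fun p => v p.2
  have hw0 : w ≠ 0 := by
    intro hw
    apply hv0
    funext i
    have := congrArg (fun u : EuclideanSpace ℂ (Fin 1 × Fin n) => u (0, i)) hw
    simpa [w] using this
  have hw : LinearMap.toContinuousLinearMap (Matrix.toEuclideanLin A) w = f.eval l • w := by
    ext p
    have := congrFun hv p.2
    simp only [Pi.smul_apply, Matrix.mulVec, dotProduct, smul_eq_mul] at this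
    simp only [LinearMap.coe_toContinuousLinearMap', Matrix.toLpLin_apply, Matrix.mulVec,
      dotProduct, PiLp.smul_apply, smul_eq_mul, w, hA, evalDelta1, Matrix.of_apply,
      Fintype.sum_prod_type]
    simpa using this.symm
  have h2 := (LinearMap.toContinuousLinearMap (Matrix.toEuclideanLin A)).le_opNorm w
  rw [hw, norm_smul] at h2
  exact lt_of_le_of_lt (le_of_mul_le_mul_right h2 (norm_pos_iff.mpr hw0)) h

theorem opNorm_eval_zero {n : ℕ} (f : Polynomial ℂ) (y : Matrix (Fin n) (Fin n) ℂ)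
    (h : Polynomial.aeval y f = 0) :
    opNorm (evalDelta1 (I := 1) (J := 1) (Matrix.of fun _ _ => f) y) < 1 := by
  have : evalDelta1 (I := 1) (J := 1) (Matrix.of fun _ _ => f) y = 0 := by
    ext p q
    simp [evalDelta1, h]
  rw [this]
  simp [opNorm]

theorem isOpen_Bdelta {I J : ℕ} (δ : Matrix (Fin I) (Fin J) (Polynomial ℂ)) :
    IsOpen (Bdelta1 δ) :=
  TopologicalSpace.isOpen_generateFrom_of_mem ⟨I, J, δ, rfl⟩

theorem isOpen_of_poly (S : Set M1)
    (h : ∀ x ∈ S, ∃ f : Polynomial ℂ, Polynomial.aeval x.2 f = 0 ∧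
      ∀ y : M1, (∀ l ∈ spectrum ℂ y.2, ‖f.eval l‖ < 1) → y ∈ S) : IsOpen S := by
  rw [isOpen_iff_forall_mem_open]
  intro x hx
  obtain ⟨f, hf, hS⟩ := h x hx
  exact ⟨Bdelta1 (I := 1) (J := 1) (Matrix.of fun _ _ => f),
    fun y hy => hS y fun l hl => opNorm_eval_lt f y.2 l hl hy,
    isOpen_Bdelta _, opNorm_eval_zero f x.2 hf⟩

theorem continuous_line (n : ℕ) (a b : Matrix (Fin (n + 1)) (Fin (n + 1)) ℂ) :
    Continuous (fun z : ℂ => (mk1 n (a + z • b))) := by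
  refine continuous_generateFrom_iff.mpr ?_
  rintro _ ⟨I, J, δ, rfl⟩
  let L : Matrix (Fin I × Fin (n + 1)) (Fin J × Fin (n + 1)) ℂ →ₗ[ℂ]
      (EuclideanSpace ℂ (Fin J × Fin (n + 1)) →L[ℂ] EuclideanSpace ℂ (Fin I × Fin (n + 1))) :=
    LinearMap.toContinuousLinearMap.toLinearMap ∘ₗ Matrix.toEuclideanLin.toLinearMap
  have hL : Continuous L := LinearMap.continuous_of_finiteDimensional L
  have hE : Continuous fun z : ℂ => evalDelta1 δ (a + z • b) := by
    refine continuous_matrix fun p q => ?_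
    simp only [evalDelta1, Matrix.of_apply]
    have : Continuous fun z : ℂ => Polynomial.aeval (a + z • b) (δ p.1 q.1) := by
      simp only [Polynomial.aeval_eq_sum_range]
      fun_prop
    exact this.matrix_elem _ _
  exact isOpen_lt (hL.comp hE).norm continuous_const

theorem one_spec (n : ℕ) (U : Set M1) (hU : IsOpen U) (h : (mk1 0 (1)) ∈ U) :
    (mk1 n (1)) ∈ U := by
  induction hU with
  | univ => trivial
  | inter s t _ _ h1 h2 => exact ⟨h1 h.1, h2 h.2⟩
  | sUnion S _ ih =>
    obtain ⟨s, hs, hx⟩ := h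
    exact ⟨s, hs, ih s hs hx⟩
  | basic s hs =>
    obtain ⟨I, J, δ, rfl⟩ := hs
    change opNorm _ < 1 at h
    refine lt_of_le_of_lt (b := opNorm (evalDelta1 δ (1 : Matrix (Fin (0 + 1)) (Fin (0 + 1)) ℂ))) ?_ h
    have hev : ∀ (m : ℕ) (p : Polynomial ℂ),
        Polynomial.aeval (1 : Matrix (Fin m) (Fin m) ℂ) p = p.eval 1 • 1 := by
      intro m p
      have := Polynomial.aeval_algebraMap_apply (Matrix (Fin m) (Fin m) ℂ) (1 : ℂ) p
      simpa [Algebra.algebraMap_eq_smul_one] using this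
    show opNorm (evalDelta1 δ (1 : Matrix (Fin (n + 1)) (Fin (n + 1)) ℂ)) ≤
      opNorm (evalDelta1 δ (1 : Matrix (Fin (0 + 1)) (Fin (0 + 1)) ℂ))
    set T := LinearMap.toContinuousLinearMap (Matrix.toEuclideanLin
      (evalDelta1 δ (1 : Matrix (Fin (0 + 1)) (Fin (0 + 1)) ℂ))) with hT
    show _ ≤ ‖T‖
    refine ContinuousLinearMap.opNorm_le_bound _ (norm_nonneg _) fun v => ?_
    let c : Fin (n + 1) → EuclideanSpace ℂ (Fin J × Fin (0 + 1)) :=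
      fun k => WithLp.toLp 2 fun p => v (p.1, k)
    refine le_of_sq_le_sq ?_ (by positivity)
    rw [mul_pow, EuclideanSpace.norm_sq_eq, EuclideanSpace.norm_sq_eq]
    have e1 : ∀ k i, (LinearMap.toContinuousLinearMap (Matrix.toEuclideanLin
        (evalDelta1 δ (1 : Matrix (Fin (n + 1)) (Fin (n + 1)) ℂ)))) v (i, k) = T (c k) (i, 0) := by
      intro k i
      simp only [LinearMap.coe_toContinuousLinearMap', Matrix.toLpLin_apply, Matrix.mulVec,
        dotProduct, hT, c, evalDelta1, Matrix.of_apply, Fintype.sum_prod_type, hev]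
      simp [Matrix.one_apply]
    rw [Fintype.sum_prod_type_right, Fintype.sum_prod_type_right, Finset.mul_sum]
    refine Finset.sum_le_sum fun k _ => ?_
    have h3 := pow_le_pow_left₀ (norm_nonneg _) (T.le_opNorm (c k)) 2
    rw [mul_pow, EuclideanSpace.norm_sq_eq, EuclideanSpace.norm_sq_eq] at h3
    simp only [Fintype.sum_prod_type_right] at h3
    simp only [e1]
    simpa [c] using h3

theorem pair_preconnected (n : ℕ) : IsPreconnected ({mk1 0 1, mk1 n 1} : Set M1) := by
  have : (mk1 n (1)) ⤳ mk1 0 1 := by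
    rw [specializes_iff_forall_open]
    intro U hU h
    exact one_spec n U hU h
  refine (isPreconnected_singleton (x := (mk1 n (1)))).subset_closure ?_ ?_
  · simp
  · rintro y (rfl | rfl)
    · exact this.mem_closure
    · exact subset_closure rfl

theorem isConnected_of_poly (S : Set M1) (h1 : ∀ n, (mk1 n (1)) ∈ S)
    (h : ∀ n a b, ∃ d : Polynomial ℂ, ∀ z : ℂ, (mk1 n (a + z • b)) ∈ S ↔ d.eval z ≠ 0) :
    IsConnected S := by
  refine ⟨⟨_, h1 0⟩, isPreconnected_of_forall (mk1 0 (1)) ?_⟩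
  rintro ⟨n, x⟩ hx
  obtain ⟨d, hd⟩ := h n x (1 - x)
  have hx0 : (mk1 n (x + (0 : ℂ) • (1 - x))) = mk1 n x := by simp
  have hx1 : (mk1 n (x + (1 : ℂ) • (1 - x))) = mk1 n 1 := by simp
  have d0 : d.eval 0 ≠ 0 := by rw [← hd, hx0]; exact hx
  have d1 : d.eval 1 ≠ 0 := by rw [← hd, hx1]; exact h1 n
  have hdne : d ≠ 0 := by rintro rfl; simp at d0
  have hfin : {z : ℂ | d.eval z = 0}.Countable :=
    (d.finite_setOfPred_isRoot hdne).countable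
  have hpc : IsPreconnected ({z : ℂ | d.eval z = 0}ᶜ) :=
    (hfin.isConnected_compl_of_one_lt_rank
      (by rw [Complex.rank_real_complex]; norm_num)).isPreconnected
  have him := hpc.image _ (continuous_line n x (1 - x)).continuousOn
  refine ⟨_ ∪ {mk1 0 1, mk1 n 1}, ?_, ?_, ?_, him.union (mk1 n (1)) ?_ ?_ (pair_preconnected n)⟩
  · rintro y (⟨z, hz, rfl⟩ | rfl | rfl)
    · exact (hd z).mpr hz
    · exact h1 0
    · exact h1 n
  · right; simp
  · left; exact ⟨0, d0, hx0⟩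
  · exact ⟨1, d1, hx1⟩
  · simp

theorem Q_iff {n : ℕ} (x : Matrix (Fin (n + 1)) (Fin (n + 1)) ℂ) :
    spectrum ℂ x ∩ spectrum ℂ (-x) = ∅ ↔ (Polynomial.aeval (-x) x.charpoly).det ≠ 0 := by
  rw [← isUnit_iff_ne_zero, ← Matrix.isUnit_iff_isUnit_det, ← spectrum.zero_notMem_iff ℂ,
    spectrum.map_polynomial_aeval_of_nonempty _ _
      (spectrum.nonempty_of_isAlgClosed_of_finiteDimensional ℂ (-x)),
    Set.eq_empty_iff_forall_notMem]
  simp only [Set.mem_inter_iff, Matrix.mem_spectrum_iff_isRoot_charpoly, Polynomial.IsRoot.def,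
    Set.mem_image]
  grind

theorem line_map {n : ℕ} (a b : Matrix (Fin n) (Fin n) ℂ) (z : ℂ) :
    (a.map Polynomial.C + (Polynomial.X : Polynomial ℂ) • b.map Polynomial.C).map
      (Polynomial.evalRingHom z) = a + z • b := by
  ext i j
  simp
  ring

theorem poly_det {n : ℕ} (a b : Matrix (Fin n) (Fin n) ℂ) :
    ∃ d : Polynomial ℂ, ∀ z, d.eval z = (a + z • b).det := by
  refine ⟨(a.map Polynomial.C + (Polynomial.X : Polynomial ℂ) • b.map Polynomial.C).det, ?_⟩
  intro z
  rw [← line_map a b z, ← Polynomial.coe_evalRingHom, RingHom.map_det]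
  rfl

theorem poly_Q {n : ℕ} (a b : Matrix (Fin n) (Fin n) ℂ) :
    ∃ d : Polynomial ℂ, ∀ z, d.eval z =
      (Polynomial.aeval (-(a + z • b)) (a + z • b).charpoly).det := by
  set M := a.map Polynomial.C + (Polynomial.X : Polynomial ℂ) • b.map Polynomial.C with hM
  refine ⟨(Polynomial.aeval (-M) M.charpoly).det, ?_⟩
  intro z
  rw [← line_map a b z, ← hM, ← Polynomial.coe_evalRingHom, RingHom.map_det, Matrix.charpoly_map]
  congr 1
  rw [Polynomial.aeval_def, Polynomial.hom_eval₂, Polynomial.aeval_def, Polynomial.eval₂_map]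
  congr 1
  · refine RingHom.ext fun p => ?_
    ext i j
    simp only [RingHom.comp_apply, RingHom.mapMatrix_apply, Matrix.map_apply,
      Matrix.algebraMap_matrix_apply]
    split_ifs <;> simp
  · ext i j
    simp

theorem poly_sym {n : ℕ} (x : Matrix (Fin (n + 1)) (Fin (n + 1)) ℂ)
    (hx : spectrum ℂ x ∩ spectrum ℂ (-x) = ∅) :
    ∃ f : Polynomial ℂ, Polynomial.aeval x f = 0 ∧ ∀ z, f.eval z + f.eval (-z) = 2 := by
  have hc : IsCoprime x.charpoly (x.charpoly.comp (-Polynomial.X)) := by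
    rw [Polynomial.isCoprime_iff_aeval_ne_zero_of_isAlgClosed ℂ ℂ]
    intro z
    by_contra! hz
    have h1 : z ∈ spectrum ℂ x := by
      rw [Matrix.mem_spectrum_iff_isRoot_charpoly]; simpa using hz.1
    have h2 : -z ∈ spectrum ℂ x := by
      rw [Matrix.mem_spectrum_iff_isRoot_charpoly]
      simpa [Polynomial.aeval_def, Polynomial.eval_comp] using hz.2
    have h3 : z ∈ spectrum ℂ (-x) := by
      rw [← spectrum.neg_eq]; simpa using h2
    exact (Set.eq_empty_iff_forall_notMem.mp hx z) ⟨h1, h3⟩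
  obtain ⟨u, v, huv⟩ := hc
  refine ⟨u * x.charpoly + v.comp (-Polynomial.X) * x.charpoly, ?_, ?_⟩
  · simp [Matrix.aeval_self_charpoly]
  · intro z
    have h1 := congrArg (Polynomial.eval z) huv
    have h2 := congrArg (Polynomial.eval (-z)) huv
    simp [Polynomial.eval_comp] at h1 h2 ⊢
    linear_combination h1 + h2

/-- The set `Inv` of invertible matrices and the set `Q = {x : σ(x) ∩ σ(-x) = ∅}` are
both open and connected in the free topology on `M¹`. -/
theorem inv_and_Q_open_connected :
    IsOpen {x : M1 | IsUnit x.2} ∧ IsConnected {x : M1 | IsUnit x.2} ∧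
    IsOpen {x : M1 | spectrum ℂ x.2 ∩ spectrum ℂ (-x.2) = ∅} ∧
    IsConnected {x : M1 | spectrum ℂ x.2 ∩ spectrum ℂ (-x.2) = ∅} := by
  refine ⟨isOpen_of_poly _ ?_, isConnected_of_poly _ ?_ ?_, isOpen_of_poly _ ?_,
    isConnected_of_poly _ ?_ ?_⟩
  · intro x hx
    have h0 : x.2.charpoly.eval 0 ≠ 0 := by
      intro h
      have : (0 : ℂ) ∈ spectrum ℂ x.2 := Matrix.mem_spectrum_iff_isRoot_charpoly.mpr h
      exact (spectrum.zero_notMem_iff ℂ).mpr hx this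
    refine ⟨Polynomial.C (2 / x.2.charpoly.eval 0) * x.2.charpoly, ?_, ?_⟩
    · simp [Matrix.aeval_self_charpoly]
    · intro y hy
      show IsUnit y.2
      rw [← spectrum.zero_notMem_iff ℂ]
      intro h
      have := hy 0 h
      rw [Polynomial.eval_mul, Polynomial.eval_C, div_mul_cancel₀ _ h0] at this
      norm_num at this
  · intro n
    exact isUnit_one
  · intro n a b
    obtain ⟨d, hd⟩ := poly_det a b
    refine ⟨d, fun z => ?_⟩
    rw [hd, ← isUnit_iff_ne_zero, ← Matrix.isUnit_iff_isUnit_det]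
    rfl
  · intro x hx
    obtain ⟨f, hf, hs⟩ := poly_sym x.2 hx
    refine ⟨f, hf, fun y hy => ?_⟩
    refine Set.eq_empty_iff_forall_notMem.mpr ?_
    rintro z ⟨h1, h2⟩
    rw [← spectrum.neg_eq] at h2
    have a1 := hy z h1
    have a2 := hy (-z) h2
    have a3 := norm_add_le (f.eval z) (f.eval (-z))
    rw [hs] at a3
    norm_num at a3
    linarith
  · intro n
    show spectrum ℂ (1 : Matrix (Fin (n + 1)) (Fin (n + 1)) ℂ) ∩
      spectrum ℂ (-1 : Matrix (Fin (n + 1)) (Fin (n + 1)) ℂ) = ∅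
    have hone : spectrum ℂ (1 : Matrix (Fin (n + 1)) (Fin (n + 1)) ℂ) = {1} := spectrum.one_eq
    rw [← spectrum.neg_eq, hone]
    refine Set.eq_empty_iff_forall_notMem.mpr ?_
    rintro z ⟨hz1, hz2⟩
    rw [Set.mem_neg, Set.mem_singleton_iff] at hz2
    rw [Set.mem_singleton_iff] at hz1
    rw [hz1] at hz2
    norm_num at hz2
  · intro n a b
    obtain ⟨d, hd⟩ := poly_Q a b
    refine ⟨d, fun z => ?_⟩
    rw [hd, ← Q_iff]
    rfl
end
end

section
/- Let Ξ = {x ∈ M¹ : √x ≠ ∅} be the set of square matrices possessing a square root in the unital algebra they generate. The interior of Ξ in the free topology on M¹ is exactly the set of invertible matrices. -/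
open Topology

noncomputable section

open Polynomial in
/-- Square root of `X` modulo a product of linear factors with nonzero roots. -/
lemma exists_sqrt_mod (s : Multiset ℂ) (hs : (0 : ℂ) ∉ s) :
    ∃ q : ℂ[X], (s.map (fun a => X - C a)).prod ∣ q ^ 2 - X := by
  induction s using Multiset.induction_on with
  | empty => exact ⟨0, by simp⟩
  | cons a s ih =>
    rw [Multiset.mem_cons, not_or] at hs
    obtain ⟨q, r, hr⟩ := ih hs.2
    set p := (s.map (fun a => X - C a)).prod with hp
    have ha : a ≠ 0 := fun h => hs.1 h.symm
    obtain ⟨c, hc⟩ : ∃ c : ℂ, r.eval a + 2 * c * q.eval a + c ^ 2 * p.eval a = 0 := by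
      by_cases hpa : p.eval a = 0
      · have h1 : q.eval a ^ 2 = a := by
          have := congrArg (Polynomial.eval a) hr
          simp [hpa] at this
          linear_combination this
        have h2 : q.eval a ≠ 0 := by
          intro h; rw [h] at h1; apply ha; rw [← h1]; simp
        refine ⟨- r.eval a / (2 * q.eval a), ?_⟩
        rw [hpa]; field_simp; ring
      · obtain ⟨z, hz⟩ := IsAlgClosed.exists_pow_nat_eq
          (q.eval a ^ 2 - p.eval a * r.eval a) (n := 2) (by norm_num)
        refine ⟨(z - q.eval a) / p.eval a, ?_⟩
        field_simp
        linear_combination hz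
    refine ⟨q + C c * p, ?_⟩
    have hd : (X - C a) ∣ r + C (2 * c) * q + C (c ^ 2) * p := by
      rw [dvd_iff_isRoot]
      simp only [IsRoot, eval_add, eval_mul, eval_C]
      exact hc
    obtain ⟨t, ht⟩ := hd
    rw [Multiset.map_cons, Multiset.prod_cons]
    refine ⟨t, ?_⟩
    have e : (q + C c * p) ^ 2 - X = p * (r + C (2 * c) * q + C (c ^ 2) * p) := by
      have e2 : (C (2 * c) : ℂ[X]) = 2 * C c := by rw [C_mul]; rfl
      have e3 : (C (c ^ 2) : ℂ[X]) = C c ^ 2 := by simp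
      rw [e2, e3]
      linear_combination hr
    rw [e, ht]; ring

lemma charpoly_eval_zero_ne {n : ℕ} (x : Matrix (Fin n) (Fin n) ℂ) (hx : IsUnit x) :
    x.charpoly.eval 0 ≠ 0 := by
  intro h
  have h1 := Matrix.det_eq_sign_charpoly_coeff x
  rw [Polynomial.coeff_zero_eq_eval_zero, h, mul_zero] at h1
  rw [Matrix.isUnit_iff_isUnit_det, h1] at hx
  exact not_isUnit_zero hx

lemma exists_sqrt_of_isUnit {n : ℕ} (x : Matrix (Fin n) (Fin n) ℂ) (hx : IsUnit x) :
    ∃ y ∈ Algebra.adjoin ℂ ({x} : Set (Matrix (Fin n) (Fin n) ℂ)), y ^ 2 = x := by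
  have h0 := charpoly_eval_zero_ne x hx
  obtain ⟨q, hq⟩ := exists_sqrt_mod x.charpoly.roots (by
    intro h
    exact h0 (Polynomial.isRoot_of_mem_roots h))
  have hsp := (IsAlgClosed.splits x.charpoly).eq_prod_roots_of_monic x.charpoly_monic
  rw [← hsp] at hq
  obtain ⟨r, hr⟩ := hq
  refine ⟨Polynomial.aeval x q, Polynomial.aeval_mem_adjoin_singleton ℂ x, ?_⟩
  have := congrArg (Polynomial.aeval x) hr
  rw [map_mul, Matrix.aeval_self_charpoly, zero_mul, map_sub, map_pow, Polynomial.aeval_X] at this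
  exact sub_eq_zero.mp this

lemma aeval_mulVec_ker {n : ℕ} (x : Matrix (Fin n) (Fin n) ℂ) (w : Fin n → ℂ)
    (hw : Matrix.mulVec x w = 0) (p : Polynomial ℂ) :
    Matrix.mulVec (Polynomial.aeval x p) w = p.eval 0 • w := by
  conv_lhs => rw [← Polynomial.divX_mul_X_add p]
  rw [map_add, map_mul, Polynomial.aeval_X, Polynomial.aeval_C, Matrix.add_mulVec,
    ← Matrix.mulVec_mulVec, hw, Matrix.mulVec_zero, zero_add, Polynomial.coeff_zero_eq_eval_zero,
    Algebra.algebraMap_eq_smul_one, Matrix.smul_mulVec, Matrix.one_mulVec]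

lemma opNorm_sq_bound {m n : Type*} [Fintype m] [Fintype n] [DecidableEq n]
    (A : Matrix m n ℂ) (v : n → ℂ) :
    ∑ i, ‖(Matrix.mulVec A v) i‖ ^ 2 ≤ opNorm A ^ 2 * ∑ j, ‖v j‖ ^ 2 := by
  have h := (LinearMap.toContinuousLinearMap (Matrix.toEuclideanLin A)).le_opNorm
    (WithLp.toLp 2 v)
  have h2 := pow_le_pow_left₀ (norm_nonneg _) h 2
  rw [mul_pow, EuclideanSpace.norm_sq_eq, EuclideanSpace.norm_sq_eq] at h2
  simpa [opNorm] using h2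

lemma opNorm_le_of_sq {m n : Type*} [Fintype m] [Fintype n] [DecidableEq n]
    (A : Matrix m n ℂ) (c : ℝ) (hc : 0 ≤ c)
    (h : ∀ v : n → ℂ, ∑ i, ‖(Matrix.mulVec A v) i‖ ^ 2 ≤ c ^ 2 * ∑ j, ‖v j‖ ^ 2) :
    opNorm A ≤ c := by
  refine ContinuousLinearMap.opNorm_le_bound _ hc fun v => ?_
  refine le_of_sq_le_sq ?_ (by positivity)
  rw [mul_pow, EuclideanSpace.norm_sq_eq, EuclideanSpace.norm_sq_eq]
  simpa using h v.ofLp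

lemma opNorm_nonneg' {m n : Type*} [Fintype m] [Fintype n] [DecidableEq n]
    (A : Matrix m n ℂ) : 0 ≤ opNorm A := norm_nonneg _

/-- Compression of `δ(x)` to the kernel of a singular `x`. -/
lemma key_bound {I J n : ℕ} (δ : Matrix (Fin I) (Fin J) (Polynomial ℂ))
    (x : Matrix (Fin n) (Fin n) ℂ) (hx : ¬ IsUnit x) (u : Fin J → ℂ) :
    ∑ i, ‖∑ j, (δ i j).eval 0 * u j‖ ^ 2 ≤ opNorm (evalDelta1 δ x) ^ 2 * ∑ j, ‖u j‖ ^ 2 := by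
  have hdet : x.det = 0 := by
    by_contra h
    exact hx ((Matrix.isUnit_iff_isUnit_det x).2 (isUnit_iff_ne_zero.2 h))
  obtain ⟨w, hw0, hw⟩ := Matrix.exists_mulVec_eq_zero_iff.2 hdet
  have h := opNorm_sq_bound (evalDelta1 δ x) (fun p => u p.1 * w p.2)
  have hW : 0 < ∑ k, ‖w k‖ ^ 2 := by
    obtain ⟨k, hk⟩ := Function.ne_iff.1 hw0
    refine Finset.sum_pos' (fun _ _ => by positivity) ⟨k, Finset.mem_univ _, ?_⟩
    have : 0 < ‖w k‖ := norm_pos_iff.2 hk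
    positivity
  have e1 : ∀ p : Fin I × Fin n, (Matrix.mulVec (evalDelta1 δ x) (fun p => u p.1 * w p.2)) p
      = (∑ j, (δ p.1 j).eval 0 * u j) * w p.2 := by
    intro p
    have hk : ∀ j, ∑ l, (Polynomial.aeval x (δ p.1 j)) p.2 l * w l = (δ p.1 j).eval 0 * w p.2 := by
      intro j
      have := congrFun (aeval_mulVec_ker x w hw (δ p.1 j)) p.2
      simpa [Matrix.mulVec, dotProduct] using this
    simp only [Matrix.mulVec, dotProduct, evalDelta1, Matrix.of_apply]
    rw [Fintype.sum_prod_type, Finset.sum_mul]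
    refine Finset.sum_congr rfl fun j _ => ?_
    have h3 := hk j
    calc _ = u j * ∑ l, (Polynomial.aeval x (δ p.1 j)) p.2 l * w l := by
            rw [Finset.mul_sum]
            exact Finset.sum_congr rfl fun l _ => by ring
      _ = _ := by rw [h3]; ring
  simp only [e1, norm_mul, mul_pow] at h
  rw [Fintype.sum_prod_type, Fintype.sum_prod_type] at h
  simp only [← Finset.mul_sum, ← Finset.sum_mul] at h
  rw [← mul_assoc] at h
  exact le_of_mul_le_mul_right h hW

lemma opNorm_zero_two_le {I J n : ℕ} (δ : Matrix (Fin I) (Fin J) (Polynomial ℂ))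
    (x : Matrix (Fin n) (Fin n) ℂ) (hx : ¬ IsUnit x) (m : ℕ) :
    opNorm (evalDelta1 δ (0 : Matrix (Fin m) (Fin m) ℂ)) ≤ opNorm (evalDelta1 δ x) := by
  refine opNorm_le_of_sq _ _ (opNorm_nonneg' _) fun v => ?_
  have e1 : ∀ p : Fin I × Fin m, (Matrix.mulVec (evalDelta1 δ 0) v) p
      = ∑ j, (δ p.1 j).eval 0 * v (j, p.2) := by
    intro p
    simp only [Matrix.mulVec, dotProduct, evalDelta1, Matrix.of_apply]
    rw [Fintype.sum_prod_type]
    refine Finset.sum_congr rfl fun j _ => ?_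
    have := congrFun (aeval_mulVec_ker (0 : Matrix (Fin m) (Fin m) ℂ) (fun l => v (j, l))
      (Matrix.zero_mulVec _) (δ p.1 j)) p.2
    simpa [Matrix.mulVec, dotProduct] using this
  simp only [e1]
  rw [Fintype.sum_prod_type_right, Fintype.sum_prod_type_right, Finset.mul_sum]
  exact Finset.sum_le_sum fun k _ => key_bound δ x hx fun j => v (j, k)

/-- The curve of nilpotents. -/
def nilCurve (ε : ℂ) : M1 := ⟨1, !![0, ε; 0, 0]⟩

lemma continuous_nilCurve : Continuous nilCurve := by
  refine continuous_generateFrom_iff.2 ?_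
  rintro _ ⟨I, J, δ, rfl⟩
  have hm : Continuous fun ε : ℂ => (!![0, ε; 0, 0] : Matrix (Fin 2) (Fin 2) ℂ) := by
    refine continuous_matrix fun i j => ?_
    fin_cases i <;> fin_cases j <;> simp <;> fun_prop
  have hE : Continuous fun ε : ℂ =>
      evalDelta1 δ (!![0, ε; 0, 0] : Matrix (Fin 2) (Fin 2) ℂ) := by
    refine continuous_matrix fun i j => ?_
    simp only [evalDelta1, Matrix.of_apply]
    exact (((δ i.1 j.1).continuous_aeval).comp hm).matrix_elem i.2 j.2
  have hN : Continuous fun A : Matrix (Fin I × Fin 2) (Fin J × Fin 2) ℂ => opNorm A := by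
    unfold opNorm
    refine continuous_norm.comp ?_
    exact LinearMap.continuous_of_finiteDimensional
      ((LinearMap.toContinuousLinearMap.toLinearMap).comp
        (Matrix.toEuclideanLin (𝕜 := ℂ) (m := Fin I × Fin 2) (n := Fin J × Fin 2)).toLinearMap)
  exact isOpen_lt (hN.comp hE) continuous_const

lemma nilCurve_zero_mem (U : Set M1) (hU : IsOpen U) (x : M1) (hx : ¬ IsUnit x.2)
    (hxU : x ∈ U) : nilCurve 0 ∈ U := by
  have hU' : TopologicalSpace.GenerateOpen
    { U | ∃ (I J : ℕ) (δ : Matrix (Fin I) (Fin J) (Polynomial ℂ)), U = Bdelta1 δ } U := hU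
  clear hU
  induction hU' with
  | basic s hs =>
    obtain ⟨I, J, δ, rfl⟩ := hs
    have h0 : (nilCurve 0).2 = (0 : Matrix (Fin 2) (Fin 2) ℂ) := by
      ext i j; fin_cases i <;> fin_cases j <;> rfl
    have hlt : opNorm (evalDelta1 δ x.2) < 1 := hxU
    show opNorm (evalDelta1 δ (nilCurve 0).2) < 1
    rw [h0]
    exact lt_of_le_of_lt (opNorm_zero_two_le δ x.2 hx 2) hlt
  | univ => trivial
  | inter s t _ _ h1 h2 => exact ⟨h1 hxU.1, h2 hxU.2⟩
  | sUnion S _ h =>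
    obtain ⟨s, hs, hxs⟩ := hxU
    exact ⟨s, hs, h s hs hxs⟩

lemma no_sqrt (ε : ℂ) (hε : ε ≠ 0) (y : Matrix (Fin 2) (Fin 2) ℂ)
    (h : y ^ 2 = !![0, ε; 0, 0]) : False := by
  have h00 := congrFun (congrFun h 0) 0
  have h01 := congrFun (congrFun h 0) 1
  have h10 := congrFun (congrFun h 1) 0
  have h11 := congrFun (congrFun h 1) 1
  simp [pow_two, Matrix.mul_apply, Fin.sum_univ_two] at h00 h01 h10 h11
  have hs : y 0 0 + y 1 1 ≠ 0 := by
    intro h0; apply hε; rw [← h01]; linear_combination y 0 1 * h0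
  have hc : y 1 0 = 0 := by
    have : y 1 0 * (y 0 0 + y 1 1) = 0 := by linear_combination h10
    exact (mul_eq_zero.1 this).resolve_right hs
  simp [hc] at h00 h11
  exact hs (by rw [h00, h11, add_zero])

lemma isOpen_isUnit : IsOpen {x : M1 | IsUnit x.2} := by
  rw [isOpen_iff_mem_nhds]
  intro x hx
  have h0 := charpoly_eval_zero_ne x.2 hx
  set p : Polynomial ℂ := Polynomial.C (2 / x.2.charpoly.eval 0) * x.2.charpoly with hp
  set δ : Matrix (Fin 1) (Fin 1) (Polynomial ℂ) := fun _ _ => p with hδ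
  have hop : IsOpen (Bdelta1 δ) := TopologicalSpace.isOpen_generateFrom_of_mem ⟨1, 1, δ, rfl⟩
  have hxB : x ∈ Bdelta1 δ := by
    have hz : evalDelta1 δ x.2 = 0 := by
      ext i j
      simp [evalDelta1, hδ, hp, Matrix.aeval_self_charpoly]
    show opNorm (evalDelta1 δ x.2) < 1
    rw [hz]
    simp [opNorm]
  refine Filter.mem_of_superset (hop.mem_nhds hxB) fun z hz => ?_
  by_contra hzu
  have hb := key_bound δ z.2 hzu (fun _ => 1)
  have hpe : p.eval 0 = 2 := by
    rw [hp, Polynomial.eval_mul, Polynomial.eval_C]; field_simp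
  have hz' : opNorm (evalDelta1 δ z.2) < 1 := hz
  have hn := opNorm_nonneg' (evalDelta1 δ z.2)
  simp [hδ, hpe] at hb
  nlinarith

/-- The interior, in the free topology, of the set `Ξ` of square matrices possessing a
square root in the unital algebra they generate is exactly the set of invertible
matrices. -/
theorem interior_Xi_eq_inv :
    interior {x : M1 | ∃ y ∈ Algebra.adjoin ℂ
        ({x.2} : Set (Matrix (Fin (x.1 + 1)) (Fin (x.1 + 1)) ℂ)), y ^ 2 = x.2} =
      {x : M1 | IsUnit x.2} := by
  apply Set.Subset.antisymm
  · intro x hx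
    by_contra hxu
    have h0 := nilCurve_zero_mem _ isOpen_interior x hxu hx
    have hn := continuous_nilCurve.continuousAt.preimage_mem_nhds (isOpen_interior.mem_nhds h0)
    have hne : ∀ᶠ ε in 𝓝[≠] (0 : ℂ), ε ≠ 0 := eventually_mem_nhdsWithin
    obtain ⟨ε, hε, hmem⟩ := (hne.and (mem_nhdsWithin_of_mem_nhds hn)).exists
    obtain ⟨y, _, hy⟩ := interior_subset hmem
    exact no_sqrt ε hε y hy
  · exact interior_maximal (fun x hx => exists_sqrt_of_isUnit x.2 hx) isOpen_isUnit
end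
end
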